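/- arXiv:1811.05973 — 4 statements merged into one kernel-verified Lean document; each statement's English description precedes it below -/
import Mathlib

section
/- Let W be a resolving set of a connected graph G. For each vertex w ∈ W, let T(w) = {x ∈ V(G) : N(w) ⊆ N(x)}. Then W' = ⋃_{w ∈ W} (N[w] ∪ T(w)) is a fault-tolerant resolving set of G. -/
/-- A set `U` of vertices is a resolving set for `G` if every two distinct
vertices are distinguished by their distance to some vertex of `U`. -/
def IsResolvingSet {V : Type*} (G : SimpleGraph V) (U : Set V) : Prop :=
  ∀ x y : V, x ≠ y → ∃ u ∈ U, G.dist x u ≠ G.dist y u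

/-- A resolving set `U` is fault-tolerant if `U \ {u}` is still a resolving set
for every `u ∈ U`. -/
def IsFaultTolerantResolvingSet {V : Type*} (G : SimpleGraph V) (U : Set V) : Prop :=
  IsResolvingSet G U ∧ ∀ u ∈ U, IsResolvingSet G (U \ {u})

namespace IsResolvingSet

variable {V : Type*} {G : SimpleGraph V}

theorem mono {U U' : Set V} (h : IsResolvingSet G U) (hU : U ⊆ U') : IsResolvingSet G U' :=
  fun x y hxy => (h x y hxy).imp fun _ hu => ⟨hU hu.1, hu.2⟩

end IsResolvingSet

namespace SimpleGraph

variable {V : Type*} {G : SimpleGraph V}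

theorem Connected.exists_adj_dist_add_one_eq (hG : G.Connected) {x w : V} (hxw : x ≠ w) :
    ∃ n, G.Adj w n ∧ G.dist x n + 1 = G.dist x w := by
  obtain ⟨p, hp⟩ := hG.exists_walk_length_eq_dist w x
  cases p with
  | nil => exact absurd rfl hxw
  | @cons _ n _ hadj q =>
    refine ⟨n, hadj, ?_⟩
    have hq := G.dist_le q
    have htri := hG.dist_triangle (u := w) (v := n) (w := x)
    rw [G.dist_eq_one_iff_adj.2 hadj] at htri
    rw [Walk.length_cons] at hp
    rw [G.dist_comm (u := x) (v := n), G.dist_comm (u := x) (v := w)]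
    omega

theorem Connected.dist_le_of_forall_adj_dist_eq (hG : G.Connected) {x y w : V} (hxw : x ≠ w)
    (h : ∀ n, G.Adj w n → G.dist x n = G.dist y n) : G.dist y w ≤ G.dist x w := by
  obtain ⟨n, hadj, hn⟩ := hG.exists_adj_dist_add_one_eq hxw
  rw [← hn, h n hadj, ← G.dist_eq_one_iff_adj.2 hadj.symm]
  exact hG.dist_triangle

theorem neighborSet_subset_of_forall_adj_dist_eq {y w : V}
    (h : ∀ n, G.Adj w n → G.dist w n = G.dist y n) : G.neighborSet w ⊆ G.neighborSet y := by
  intro n hn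
  exact G.dist_eq_one_iff_adj.1 ((h n hn).symm.trans (G.dist_eq_one_iff_adj.2 hn))

end SimpleGraph

/-- If `W` is a resolving set of a connected graph `G`, then
`W' = ⋃_{w ∈ W} (N[w] ∪ T(w))`, where `T(w) = {x : N(w) ⊆ N(x)}`, is a
fault-tolerant resolving set of `G`. -/
theorem faultTolerant_of_resolving {V : Type*} (G : SimpleGraph V) (hG : G.Connected)
    (W : Set V) (hW : IsResolvingSet G W) :
    IsFaultTolerantResolvingSet G
      (⋃ w ∈ W, (insert w (G.neighborSet w) ∪
        {x : V | G.neighborSet w ⊆ G.neighborSet x})) := by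
  set S := ⋃ w ∈ W, (insert w (G.neighborSet w) ∪
    {x : V | G.neighborSet w ⊆ G.neighborSet x})
  have hmem {w x : V} (hw : w ∈ W) (hx : (x = w ∨ G.Adj w x) ∨
      G.neighborSet w ⊆ G.neighborSet x) : x ∈ S := Set.mem_biUnion hw hx
  refine ⟨hW.mono fun w hw => hmem hw (.inl (.inl rfl)), fun u _ x y hxy => ?_⟩
  obtain ⟨w, hw, hd⟩ := hW x y hxy
  by_contra! hcon
  have hwu : w = u := by
    by_contra hne
    exact hd (hcon w ⟨hmem hw (.inl (.inl rfl)), hne⟩)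
  subst hwu
  have hN : ∀ n, G.Adj w n → G.dist x n = G.dist y n := fun n hn =>
    hcon n ⟨hmem hw (.inl (.inr hn)), hn.ne'⟩
  have hN' : ∀ n, G.Adj w n → G.dist y n = G.dist x n := fun n hn => (hN n hn).symm
  by_cases hx : x = w
  · subst hx
    have hy := hcon y
      ⟨hmem hw (.inr (SimpleGraph.neighborSet_subset_of_forall_adj_dist_eq hN)), hxy.symm⟩
    exact hxy (hG.dist_eq_zero_iff.1 (hy.trans G.dist_self))
  by_cases hy : y = w
  · subst hy
    have hx := hcon x
      ⟨hmem hw (.inr (SimpleGraph.neighborSet_subset_of_forall_adj_dist_eq hN')), hxy⟩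
    exact hxy (hG.dist_eq_zero_iff.1 (hx.symm.trans G.dist_self)).symm
  exact hd ((hG.dist_le_of_forall_adj_dist_eq hy hN').antisymm
    (hG.dist_le_of_forall_adj_dist_eq hx hN))
end

section
/- Let W be a resolving set in a connected graph G and let k ≥ 1. Then for each vertex w ∈ W, the number of vertices of G at distance at most k from w is at most 1 + k·(2k+1)^{|W|−1}. -/
/-- If `W` is a resolving set of a connected graph `G` and `k ≥ 1`, then for each
`w ∈ W` the number of vertices at distance at most `k` from `w` is at most
`1 + k·(2k+1)^(|W|-1)`. -/
theorem card_ball_le_of_resolving {V : Type*} [Fintype V] (G : SimpleGraph V)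
    (hG : G.Connected) (W : Finset V) (hW : IsResolvingSet G ↑W)
    (k : ℕ) (hk : 1 ≤ k) (w : V) (hw : w ∈ W) :
    (Finset.univ.filter (fun v : V => G.dist w v ≤ k)).card ≤
      1 + k * (2 * k + 1) ^ (W.card - 1) := by
  classical
  have ball_eq : Finset.univ.filter (fun v : V => G.dist w v ≤ k) =
      insert w (Finset.univ.filter fun v : V => v ≠ w ∧ G.dist w v ≤ k) := by
    ext v
    by_cases h : v = w <;> simp [h]
  rw [ball_eq, Finset.card_insert_of_notMem (by simp), add_comm]
  refine Nat.add_le_add_left ?_ 1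
  have target_card : (Finset.Icc 1 k ×ˢ
      Fintype.piFinset fun _ : W.erase w => Finset.range (2 * k + 1)).card =
      k * (2 * k + 1) ^ (W.card - 1) := by
    simp [Finset.card_erase_of_mem hw]
  rw [← target_card]
  -- By the triangle inequality the natural subtraction below never truncates.
  have dist_le (v u : V) : G.dist w u ≤ G.dist w v + G.dist v u := hG.dist_triangle
  refine Finset.card_le_card_of_injOn
    (fun v => (G.dist w v, fun u : W.erase w => G.dist v u + k - G.dist w u)) ?_ ?_
  · intro v hv
    obtain ⟨hvw, hvk⟩ : v ≠ w ∧ G.dist w v ≤ k := by simpa using hv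
    have hpos : 0 < G.dist w v := hG.pos_dist_of_ne hvw.symm
    simp only [Finset.coe_product, Set.mem_prod, Finset.mem_coe, Finset.mem_Icc,
      Fintype.mem_piFinset, Finset.mem_range]
    refine ⟨⟨hpos, hvk⟩, fun u => ?_⟩
    have hvu : G.dist v u ≤ G.dist v w + G.dist w u := hG.dist_triangle
    rw [G.dist_comm (u := v) (v := w)] at hvu
    omega
  · intro x hx y hy hxy
    have hxk : G.dist w x ≤ k := by
      have h : x ≠ w ∧ G.dist w x ≤ k := by simpa using hx
      exact h.2
    have hyk : G.dist w y ≤ k := by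
      have h : y ≠ w ∧ G.dist w y ≤ k := by simpa using hy
      exact h.2
    obtain ⟨hdist, hdiff⟩ := Prod.mk.inj hxy
    by_contra hne
    obtain ⟨u, hu, hxyu⟩ := hW x y hne
    by_cases huw : u = w
    · subst huw
      exact hxyu (by rw [G.dist_comm, hdist, G.dist_comm])
    · have h : G.dist x u + k - G.dist w u = G.dist y u + k - G.dist w u :=
        congrFun hdiff ⟨u, Finset.mem_erase.mpr ⟨huw, hu⟩⟩
      have hx' := dist_le x u
      have hy' := dist_le y u
      omega
end

section
/- Let W be a metric basis of a connected graph G (so |W| = β(G)). Then for each vertex w ∈ W, |N[w] ∪ T(w)| ≤ 1 + 2·5^{β(G)−1}, where T(w) = {x ∈ V(G) : N(w) ⊆ N(x)}. -/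
/-- A vertex other than `w` in `N(w)`, or whose neighborhood contains `N(w)`, is at distance
`1` or `2` from `w`. -/
theorem dist_mem_of_mem_closedNbhd_union {V : Type*} {G : SimpleGraph V} (hG : G.Connected)
    {w x : V} (hxw : x ≠ w)
    (hx : x ∈ insert w (G.neighborSet w) ∪ {x : V | G.neighborSet w ⊆ G.neighborSet x}) :
    G.dist x w ∈ ({1, 2} : Finset ℕ) := by
  have hpos := hG.pos_dist_of_ne hxw
  suffices h : G.dist x w ≤ 2 by
    simp only [Finset.mem_insert, Finset.mem_singleton]
    omega
  rcases hx with (rfl | hx) | hx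
  · exact absurd rfl hxw
  · have hadj : G.Adj x w := SimpleGraph.Adj.symm hx
    exact (SimpleGraph.dist_eq_one_iff_adj.mpr hadj).le.trans one_le_two
  · obtain ⟨p⟩ := hG.preconnected w x
    cases p with
    | nil => exact absurd rfl hxw
    | cons hwy _ =>
      exact SimpleGraph.dist_le (.cons (hx hwy) (.cons hwy.symm .nil))

/-- In a connected graph, vertices whose distances to the members of a resolving set `W` lie in
prescribed finite sets are at most as many as the product of the sizes of these sets. -/
theorem card_le_prod_of_isResolvingSet {V : Type*} {G : SimpleGraph V} {W S : Finset V}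
    (hW : IsResolvingSet G ↑W) (R : V → Finset ℕ)
    (hR : ∀ x ∈ S, ∀ u ∈ W, G.dist x u ∈ R u) :
    S.card ≤ ∏ u ∈ W, (R u).card := by
  classical
  rw [← Finset.card_pi]
  refine Finset.card_le_card_of_injOn (fun x u _ => G.dist x u) ?_ ?_
  · intro x hx
    exact Finset.mem_pi.mpr (hR x hx)
  · intro x _ y _ hxy
    by_contra hne
    obtain ⟨u, hu, hdist⟩ := hW x y hne
    exact hdist (congrFun (congrFun hxy u) hu)

/-- If `W` is a metric basis of a connected graph `G` (a resolving set of minimum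
cardinality, so `|W| = β(G)`), then for each `w ∈ W` we have
`|N[w] ∪ T(w)| ≤ 1 + 2·5^(β(G)-1)`, where `T(w) = {x : N(w) ⊆ N(x)}`. -/
theorem card_closedNbhd_union_T_le {V : Type*} [Fintype V] (G : SimpleGraph V)
    (hG : G.Connected) (W : Finset V)
    (hW : IsResolvingSet G ↑W)
    (hmin : ∀ U : Finset V, IsResolvingSet G ↑U → W.card ≤ U.card)
    (w : V) (hw : w ∈ W) :
    (insert w (G.neighborSet w) ∪
      {x : V | G.neighborSet w ⊆ G.neighborSet x}).ncard ≤
      1 + 2 * 5 ^ (W.card - 1) := by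
  classical
  set A := insert w (G.neighborSet w) ∪ {x : V | G.neighborSet w ⊆ G.neighborSet x}
  set S := A.toFinset.erase w with hS
  have hAS : A.ncard ≤ S.card + 1 := by
    rw [Set.ncard_eq_toFinset_card']
    exact Nat.sub_le_iff_le_add.mp Finset.pred_card_le_card_erase
  have hSW : S.card ≤ ∏ u ∈ W, (if u = w then ({1, 2} : Finset ℕ) else
      Finset.Icc (G.dist w u - 2) (G.dist w u + 2)).card := by
    refine card_le_prod_of_isResolvingSet hW _ fun x hx u _ => ?_
    rw [hS, Finset.mem_erase, Set.mem_toFinset] at hx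
    have hxw := dist_mem_of_mem_closedNbhd_union hG hx.1 hx.2
    split_ifs with huw
    · rwa [huw]
    · simp only [Finset.mem_insert, Finset.mem_singleton] at hxw
      have h₁ := hG.dist_triangle (u := x) (v := w) (w := u)
      have h₂ := hG.dist_triangle (u := w) (v := x) (w := u)
      rw [G.dist_comm (u := w) (v := x)] at h₂
      rw [Finset.mem_Icc]
      omega
  rw [← Finset.mul_prod_erase W _ hw, if_pos rfl] at hSW
  have hprod : ∏ u ∈ W.erase w, (if u = w then ({1, 2} : Finset ℕ) else
      Finset.Icc (G.dist w u - 2) (G.dist w u + 2)).card ≤ 5 ^ (W.card - 1) := by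
    rw [← Finset.card_erase_of_mem hw]
    refine Finset.prod_le_pow_card _ _ _ fun u hu => ?_
    rw [if_neg (Finset.ne_of_mem_erase hu), Nat.card_Icc]
    omega
  have htwo : ({1, 2} : Finset ℕ).card = 2 := rfl
  rw [htwo] at hSW
  omega
end

section
/- For every connected graph G, the fault-tolerant metric dimension satisfies β'(G) ≤ β(G)·(1 + 2·5^{β(G)−1}). In particular, the fault-tolerant metric dimension is bounded above by a function of the metric dimension alone, independent of the graph. -/
/-- The metric dimension `β(G)`: the minimum cardinality of a resolving set. -/
noncomputable def metricDim {V : Type*} (G : SimpleGraph V) : ℕ :=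
  sInf {m : ℕ | ∃ U : Finset V, IsResolvingSet G ↑U ∧ U.card = m}

/-- The fault-tolerant metric dimension `β'(G)`: the minimum cardinality of a
fault-tolerant resolving set. -/
noncomputable def ftMetricDim {V : Type*} (G : SimpleGraph V) : ℕ :=
  sInf {m : ℕ | ∃ U : Finset V, IsFaultTolerantResolvingSet G ↑U ∧ U.card = m}

/-- A ball of radius two about a member `s` of a resolving set `S` is small: its points other than
`s` are determined by their distances to `S`, and the distance to each `t ∈ S` differs by at most
two from that of `s`. -/
theorem IsResolvingSet.card_dist_le_two {V : Type*} [Fintype V]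
    {G : SimpleGraph V} (hG : G.Connected) {S : Finset V} (hS : IsResolvingSet G ↑S)
    {s : V} (hs : s ∈ S) :
    (Finset.univ.filter fun x => G.dist x s ≤ 2).card ≤ 1 + 2 * 5 ^ (S.card - 1) := by
  classical
  have hsub : (Finset.univ.filter fun x => G.dist x s ≤ 2) ⊆
      {s} ∪ Finset.univ.filter fun x => G.dist x s ∈ Finset.Icc 1 2 := by
    intro x hx
    by_cases hxs : x = s
    · simp [hxs]
    · have := hG.pos_dist_of_ne hxs
      simp only [Finset.mem_filter, Finset.mem_univ, true_and] at hx
      simp [hx, Nat.succ_le_iff, this]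
  have hpunctured : (Finset.univ.filter fun x => G.dist x s ∈ Finset.Icc 1 2).card ≤
      2 * 5 ^ (S.card - 1) := by
    have hcard : (Finset.Icc 1 2 ×ˢ
        Fintype.piFinset fun _ : S.erase s => Finset.range 5).card = 2 * 5 ^ (S.card - 1) := by
      simp [Finset.card_product, Fintype.card_piFinset, Finset.card_erase_of_mem hs]
    rw [← hcard]
    refine Finset.card_le_card_of_injOn
      (fun x => (G.dist x s, fun t : S.erase s => G.dist x t + 2 - G.dist s t)) ?_ ?_
    · intro x hx
      simp only [Finset.coe_filter, Finset.mem_univ, true_and, Set.mem_ofPred_eq] at hx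
      refine Finset.mem_coe.2 (Finset.mem_product.2 ⟨hx, Fintype.mem_piFinset.2 fun t => ?_⟩)
      have := hG.dist_triangle (u := x) (v := s) (w := (t : V))
      simp only [Finset.mem_Icc, Finset.mem_range] at hx ⊢
      omega
    · intro x hx y hy hxy
      by_contra hne
      obtain ⟨t, ht, hdist⟩ := hS x y hne
      simp only [Finset.coe_filter, Finset.mem_univ, true_and, Set.mem_ofPred_eq,
        Finset.mem_Icc] at hx hy
      obtain ⟨h_center, h_rest⟩ := Prod.mk.inj hxy
      by_cases hts : t = s
      · exact hdist (hts ▸ h_center)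
      · have heq := congrFun h_rest ⟨t, Finset.mem_erase.2 ⟨hts, ht⟩⟩
        have hsx := hG.dist_triangle (u := s) (v := x) (w := t)
        have hsy := hG.dist_triangle (u := s) (v := y) (w := t)
        rw [G.dist_comm (u := s) (v := x)] at hsx
        rw [G.dist_comm (u := s) (v := y)] at hsy
        dsimp only at heq
        omega
  calc _ ≤ _ := Finset.card_le_card hsub
    _ ≤ _ := Finset.card_union_le _ _
    _ ≤ _ := by simpa using hpunctured

/-- If `u` is strictly closer to `x` than to `y`, then so is some other vertex within distance two
of `u`. -/
theorem SimpleGraph.Connected.exists_ne_dist_ne_of_dist_lt {V : Type*} {G : SimpleGraph V}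
    (hG : G.Connected) {x y u : V} (h : G.dist x u < G.dist y u) :
    ∃ w, w ≠ u ∧ G.dist w u ≤ 2 ∧ G.dist x w ≠ G.dist y w := by
  have key : ∀ z, z ≠ u → ∃ w, G.Adj u w ∧ G.dist z w + 1 = G.dist z u := by
    intro z hz
    obtain ⟨p, hp⟩ := hG.exists_walk_length_eq_dist u z
    cases p with
    | nil => exact absurd rfl hz
    | @cons _ w _ hadj q =>
      refine ⟨w, hadj, ?_⟩
      have hq := SimpleGraph.dist_le q
      have htri := hG.dist_triangle (u := u) (v := w) (w := z)
      rw [SimpleGraph.dist_eq_one_iff_adj.2 hadj] at htri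
      rw [SimpleGraph.Walk.length_cons] at hp
      rw [G.dist_comm (u := z), G.dist_comm (u := z)]
      omega
  have hadj_dist : ∀ w, G.Adj u w → w ≠ u ∧ G.dist w u = 1 := fun w hw =>
    ⟨hw.ne', SimpleGraph.dist_eq_one_iff_adj.2 hw.symm⟩
  by_cases hx : x = u
  · subst hx
    have hy : y ≠ x := by
      rintro rfl
      exact lt_irrefl _ h
    by_cases hyx : G.dist y x ≤ 2
    · refine ⟨y, hy, hyx, ?_⟩
      rw [SimpleGraph.dist_self]
      exact (hG.pos_dist_of_ne hy.symm).ne'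
    · obtain ⟨w, hw, hdist⟩ := key y hy
      obtain ⟨hne, hone⟩ := hadj_dist w hw
      refine ⟨w, hne, by omega, ?_⟩
      rw [G.dist_comm (u := x)]
      omega
  · obtain ⟨w, hw, hdist⟩ := key x hx
    obtain ⟨hne, hone⟩ := hadj_dist w hw
    have htri := hG.dist_triangle (u := y) (v := w) (w := u)
    exact ⟨w, hne, by omega, by omega⟩

/-- The vertices within distance two of a resolving set form a fault-tolerant resolving set. -/
theorem IsResolvingSet.isFaultTolerantResolvingSet {V : Type*} {G : SimpleGraph V}
    (hG : G.Connected) {S U : Set V} (hS : IsResolvingSet G S)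
    (hU : ∀ s ∈ S, ∀ x, G.dist x s ≤ 2 → x ∈ U) : IsFaultTolerantResolvingSet G U := by
  have hSU : S ⊆ U := fun s hs => hU s hs s (by simp)
  refine ⟨fun x y hxy => ?_, fun u _ x y hxy => ?_⟩
  · obtain ⟨s, hs, h⟩ := hS x y hxy
    exact ⟨s, hSU hs, h⟩
  · obtain ⟨s, hs, h⟩ := hS x y hxy
    by_cases hsu : s = u
    · subst hsu
      rcases lt_or_gt_of_ne h with hlt | hlt
      · obtain ⟨w, hne, hw, hdist⟩ := hG.exists_ne_dist_ne_of_dist_lt hlt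
        exact ⟨w, ⟨hU s hs w hw, hne⟩, hdist⟩
      · obtain ⟨w, hne, hw, hdist⟩ := hG.exists_ne_dist_ne_of_dist_lt hlt
        exact ⟨w, ⟨hU s hs w hw, hne⟩, hdist.symm⟩
    · exact ⟨s, ⟨hSU hs, hsu⟩, h⟩

/-- The metric dimension of a connected finite graph is attained by some resolving set. -/
theorem exists_isResolvingSet_card_eq_metricDim {V : Type*} [Fintype V] {G : SimpleGraph V}
    (hG : G.Connected) : ∃ S : Finset V, IsResolvingSet G ↑S ∧ S.card = metricDim G := by
  refine Nat.sInf_mem (s := {m : ℕ | ∃ U : Finset V, IsResolvingSet G ↑U ∧ U.card = m})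
    ⟨_, Finset.univ, fun x y hxy => ⟨x, by simp, ?_⟩, rfl⟩
  rw [SimpleGraph.dist_self]
  exact (hG.pos_dist_of_ne hxy.symm).ne

/-- For every connected graph `G`,
`β'(G) ≤ β(G)·(1 + 2·5^(β(G)-1))`; in particular the fault-tolerant metric
dimension is bounded above by a function of the metric dimension alone. -/
theorem ftMetricDim_le {V : Type*} [Fintype V] (G : SimpleGraph V) (hG : G.Connected) :
    ftMetricDim G ≤ metricDim G * (1 + 2 * 5 ^ (metricDim G - 1)) := by
  classical
  obtain ⟨S, hS, hcard⟩ := exists_isResolvingSet_card_eq_metricDim hG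
  let U := S.biUnion fun s => Finset.univ.filter fun x => G.dist x s ≤ 2
  have hU : IsFaultTolerantResolvingSet G ↑U := hS.isFaultTolerantResolvingSet hG
    fun s hs x hx => Finset.mem_coe.2 (Finset.mem_biUnion.2 ⟨s, hs, by simpa using hx⟩)
  calc ftMetricDim G ≤ U.card := Nat.sInf_le ⟨U, hU, rfl⟩
    _ ≤ S.card * (1 + 2 * 5 ^ (S.card - 1)) :=
      Finset.card_biUnion_le_card_mul _ _ _ fun s hs => hS.card_dist_le_two hG hs
    _ = metricDim G * (1 + 2 * 5 ^ (metricDim G - 1)) := by rw [hcard]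
end
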